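/- arXiv:1106.1192 — 2 statements merged into one kernel-verified Lean document; each statement's English description precedes it below -/
import Mathlib

section
/- For every η > 0 there exists δ = δ(η) > 0 such that the following holds. Let u : Ω → ℝ² be an L bi-Lipschitz map on an open set Ω ⊆ ℝ², let z̄ ∈ Ω, let M be a 2×2 matrix with positive determinant satisfying |M| ≤ L and |M⁻¹| ≤ L, and let ρ > 0 be such that the closed square D(z̄, ρ) of center z̄ and side ρ is compactly contained in Ω. If the average of |Du(z) − M| over D(z̄, ρ) is at most δ, then there exists an affine function u_M : ℝ² → ℝ² with Du_M = M such that |u(z) − u_M(z)| ≤ η ρ for every z ∈ D(z̄, ρ). -/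
open MeasureTheory Set

noncomputable section

abbrev Pt := EuclideanSpace ℝ (Fin 2)

/-- The closed axis-parallel square of center `z` and side length `r`. -/
def SquareD (z : Pt) (r : ℝ) : Set Pt := {w | ∀ i, |w i - z i| ≤ r / 2}

/-- `f` is `L` bi-Lipschitz on `s`. -/
def BiLipOn (L : ℝ) (s : Set Pt) (f : Pt → Pt) : Prop :=
  ∀ x ∈ s, ∀ y ∈ s,
    (1 / L) * dist x y ≤ dist (f x) (f y) ∧ dist (f x) (f y) ≤ L * dist x y

/-- Integrating the increments `v (h + w) - v h` of a Lipschitz map over a bounded set `S` all of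
whose translates `S + t w`, `0 ≤ t ≤ 1`, lie in `Q` costs at most `‖w‖` times the integral over `Q`
of a bound for the derivative of `v`. -/
theorem LipschitzWith.norm_setIntegral_increment_le {E F : Type*}
    [NormedAddCommGroup E] [NormedSpace ℝ E] [FiniteDimensional ℝ E] [MeasurableSpace E]
    [BorelSpace E] [NormedAddCommGroup F] [NormedSpace ℝ F] [FiniteDimensional ℝ F]
    (μ : Measure E) [μ.IsAddHaarMeasure] {v : E → F} {K : NNReal} (hv : LipschitzWith K v)
    {S Q : Set E} (hS : MeasurableSet S) (hSb : Bornology.IsBounded S) (hQ : MeasurableSet Q)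
    {w : E} (hw : ∀ t ∈ Icc (0 : ℝ) 1, ∀ h ∈ S, h + t • w ∈ Q)
    {f : E → ℝ} (hf : IntegrableOn f Q μ) (hvf : ∀ z ∈ Q, ‖fderiv ℝ v z‖ ≤ f z) :
    ‖∫ h in S, (v (h + w) - v h) ∂μ‖ ≤ ‖w‖ * ∫ z in Q, f z ∂μ := by
  have hSfin : IsFiniteMeasure (μ.restrict S) := ⟨by simpa using hSb.measure_lt_top⟩
  have hcont : ∀ t : ℝ, Continuous fun h => v (h + t • w) := fun t =>
    hv.continuous.comp (continuous_id.add continuous_const)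
  have hint : ∀ t : ℝ, IntegrableOn (fun h => v (h + t • w)) S μ := fun t =>
    ((hcont t).continuousOn.integrableOn_compact
      (Metric.isCompact_of_isClosed_isBounded isClosed_closure hSb.closure)).mono_set
      subset_closure
  set g : ℝ → F := fun t => ∫ h in S, v (h + t • w) ∂μ with hg
  have hder : ∀ t : ℝ, HasDerivAt g (∫ h in S, fderiv ℝ v (h + t • w) w ∂μ) t := by
    intro t
    refine (hasDerivAt_integral_of_dominated_loc_of_lip (F := fun t h => v (h + t • w))
      (bound := fun _ => (K : ℝ) * ‖w‖) Filter.univ_mem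
      (Filter.Eventually.of_forall fun s => (hcont s).aestronglyMeasurable) (hint t)
      ?_ ?_ (integrable_const _) ?_).2
    · exact (((measurable_fderiv ℝ v).comp
        (measurable_id.add_const (t • w))).aestronglyMeasurable).apply_continuousLinearMap w
    · refine Filter.Eventually.of_forall fun h => LipschitzOnWith.of_dist_le_mul fun a _ b _ => ?_
      refine (hv.dist_le_mul _ _).trans (le_of_eq ?_)
      rw [dist_add_left, dist_eq_norm, ← sub_smul, norm_smul, ← dist_eq_norm,
        Real.coe_nnabs, abs_of_nonneg (by positivity)]
      ring
    · have hae : ∀ᵐ h ∂μ, DifferentiableAt ℝ v (h + t • w) :=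
        (measurePreserving_add_right μ (t • w)).quasiMeasurePreserving.ae
          hv.ae_differentiableAt
      filter_upwards [ae_restrict_of_ae hae] with h hh
      have hline : HasDerivAt (fun s : ℝ => h + s • w) w t := by
        simpa using ((hasDerivAt_id t).smul_const w).const_add h
      exact hh.hasFDerivAt.comp_hasDerivAt t hline
  have hbound : ∀ t ∈ Icc (0 : ℝ) 1,
      ‖∫ h in S, fderiv ℝ v (h + t • w) w ∂μ‖ ≤ ‖w‖ * ∫ z in Q, f z ∂μ := by
    intro t ht
    have hpre : S ⊆ (fun h => h + t • w) ⁻¹' Q := fun h hh => hw t ht h hh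
    have hmp := measurePreserving_add_right μ (t • w)
    have hemb : MeasurableEmbedding (fun h : E => h + t • w) := measurableEmbedding_addRight _
    have hfpre : IntegrableOn (fun h => f (h + t • w)) ((fun h => h + t • w) ⁻¹' Q) μ :=
      (hmp.integrableOn_comp_preimage hemb).2 hf
    calc ‖∫ h in S, fderiv ℝ v (h + t • w) w ∂μ‖
        ≤ ∫ h in S, ‖w‖ * f (h + t • w) ∂μ := by
          refine norm_integral_le_of_norm_le ((hfpre.mono_set hpre).const_mul _) ?_
          refine (ae_restrict_iff' hS).2 (Filter.Eventually.of_forall fun h hh => ?_)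
          rw [mul_comm]
          exact ((fderiv ℝ v _).le_opNorm w).trans
            (mul_le_mul_of_nonneg_right (hvf _ (hpre hh)) (norm_nonneg _))
      _ = ‖w‖ * ∫ h in S, f (h + t • w) ∂μ := integral_const_mul _ _
      _ ≤ ‖w‖ * ∫ h in (fun h => h + t • w) ⁻¹' Q, f (h + t • w) ∂μ := by
          refine mul_le_mul_of_nonneg_left (setIntegral_mono_set hfpre ?_ hpre.eventuallyLE)
            (norm_nonneg _)
          exact (ae_restrict_iff' (hemb.measurable hQ)).2 (Filter.Eventually.of_forall
            fun h hh => (norm_nonneg _).trans (hvf _ hh))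
      _ = ‖w‖ * ∫ z in Q, f z ∂μ := by rw [hmp.setIntegral_preimage_emb hemb]
  have hmv := (convex_Icc (0 : ℝ) 1).norm_image_sub_le_of_norm_hasDerivWithin_le
    (fun t _ => (hder t).hasDerivWithinAt) hbound (left_mem_Icc.2 zero_le_one)
    (right_mem_Icc.2 zero_le_one)
  have hsub : ∫ h in S, (v (h + w) - v h) ∂μ = g 1 - g 0 := by
    simpa [hg] using integral_sub (hint 1) (hint 0)
  rw [hsub]
  simpa using hmv

theorem isClosed_squareD (z : Pt) (r : ℝ) : IsClosed (SquareD z r) := by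
  simp only [SquareD, ofPred_forall]
  exact isClosed_iInter fun i => isClosed_le (by fun_prop) continuous_const

theorem squareD_subset_closedBall (z : Pt) {r : ℝ} (hr : 0 ≤ r) :
    SquareD z r ⊆ Metric.closedBall z r := by
  intro x hx
  rw [Metric.mem_closedBall, EuclideanSpace.dist_eq]
  refine Real.sqrt_le_iff.2 ⟨hr, ?_⟩
  have h (i : Fin 2) : dist (x i) (z i) ^ 2 ≤ (r / 2) ^ 2 :=
    pow_le_pow_left₀ dist_nonneg (hx i) 2
  rw [Fin.sum_univ_two]
  nlinarith [h 0, h 1, sq_nonneg r]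

theorem add_smul_mem_interior_squareD {z x h : Pt} {r ε t : ℝ} (hε1 : ε ≤ 1)
    (hx : x ∈ SquareD z r) (hh : h ∈ Metric.ball z (ε * r / 2)) (ht : t ∈ Icc (0 : ℝ) 1) :
    h + t • ((1 - ε) • (x - z)) ∈ interior (SquareD z r) := by
  set c := z + t • ((1 - ε) • (x - z)) with hc
  have hsub : Metric.ball c (ε * r / 2) ⊆ SquareD z r := by
    intro y hy i
    have h1 : |y i - c i| ≤ ε * r / 2 := by
      have := PiLp.norm_apply_le (y - c) i
      rw [← dist_eq_norm] at this
      simpa using this.trans (Metric.mem_ball.1 hy).le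
    have h2 : |c i - z i| ≤ (1 - ε) * (r / 2) := by
      have : c i - z i = t * ((1 - ε) * (x i - z i)) := by simp [hc]
      rw [this, abs_mul, abs_mul, abs_of_nonneg ht.1, abs_of_nonneg (sub_nonneg.2 hε1)]
      have h3 : (1 - ε) * |x i - z i| ≤ (1 - ε) * (r / 2) :=
        mul_le_mul_of_nonneg_left (hx i) (sub_nonneg.2 hε1)
      have h4 : 0 ≤ (1 - ε) * |x i - z i| := mul_nonneg (sub_nonneg.2 hε1) (abs_nonneg _)
      nlinarith [ht.2]
    calc |y i - z i| ≤ |y i - c i| + |c i - z i| := abs_sub_le _ _ _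
      _ ≤ r / 2 := by linarith
  refine interior_maximal hsub Metric.isOpen_ball ?_
  simpa [hc, Metric.mem_ball] using hh

/-- Quantitative form: the oscillation of a Lipschitz map on a square, in terms of the integral of
its derivative and of a parameter `ε`. -/
theorem LipschitzWith.norm_sub_center_le_of_integral_le {v : Pt → Pt} {K : NNReal}
    (hv : LipschitzWith K v) {z x : Pt} {r ε δ : ℝ} (hr : 0 < r) (hε : 0 < ε) (hε1 : ε ≤ 1)
    (hδ : 0 ≤ δ) (hx : x ∈ SquareD z r) {f : Pt → ℝ}
    (hf : IntegrableOn f (interior (SquareD z r)))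
    (hvf : ∀ y ∈ interior (SquareD z r), ‖fderiv ℝ v y‖ ≤ f y)
    (hfδ : ∫ y in interior (SquareD z r), f y ≤ volume.real (SquareD z r) * δ) :
    ‖v x - v z‖ ≤ 2 * K * ε * r + r * δ * (4 / ε ^ 2) := by
  set S := Metric.ball z (ε * r / 2) with hSdef
  set w := (1 - ε) • (x - z) with hw
  have hxz : ‖x - z‖ ≤ r := by
    simpa [dist_eq_norm] using squareD_subset_closedBall z hr.le hx
  have hwr : ‖w‖ ≤ r := by
    rw [hw, norm_smul, Real.norm_of_nonneg (sub_nonneg.2 hε1)]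
    nlinarith [norm_nonneg (x - z)]
  have hinc := hv.norm_setIntegral_increment_le volume (S := S) measurableSet_ball
    Metric.isBounded_ball isOpen_interior.measurableSet
    (fun t ht h hh => add_smul_mem_interior_squareD hε1 hx hh ht) hf hvf
  have hvolQ : volume.real (SquareD z r) ≤ 4 / ε ^ 2 * volume.real S := by
    have h1 : volume.real (SquareD z r) ≤ volume.real (Metric.closedBall z r) :=
      measureReal_mono (squareD_subset_closedBall z hr.le) measure_closedBall_lt_top.ne
    have h2 : volume.real (Metric.closedBall z r) = Real.pi * r ^ 2 := by
      simp [measureReal_def, EuclideanSpace.volume_closedBall_fin_two, hr.le, Real.pi_nonneg, mul_comm]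
    have h3 : volume.real S = Real.pi * (ε * r / 2) ^ 2 := by
      have : 0 ≤ ε * r / 2 := by positivity
      rw [hSdef, measureReal_def, EuclideanSpace.volume_ball_fin_two, ENNReal.toReal_mul,
        ENNReal.toReal_pow, ENNReal.toReal_ofReal this, mul_comm]
      simp [Real.pi_nonneg]
    rw [h3]
    refine (h1.trans h2.le).trans (le_of_eq ?_)
    field_simp
    norm_num
  have hSpos : 0 < volume.real S :=
    ENNReal.toReal_pos (Metric.measure_ball_pos _ _ (by positivity)).ne' measure_ball_lt_top.ne
  have hint (a : Pt) : IntegrableOn (fun h => v (h + a)) S :=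
    ((hv.continuous.comp (continuous_id.add continuous_const)).continuousOn.integrableOn_compact
      (isCompact_closedBall z (ε * r / 2))).mono_set Metric.ball_subset_closedBall
  have hincint : IntegrableOn (fun h => v (h + w) - v h) S := by
    have := (hint w).sub (hint 0)
    simp only [add_zero] at this
    exact this
  have herr : ‖∫ h in S, ((v x - v z) - (v (h + w) - v h))‖
      ≤ (2 * K * ε * r) * volume.real S := by
    refine norm_setIntegral_le_of_norm_le_const measure_ball_lt_top fun h hh => ?_
    have hhz : ‖z - h‖ ≤ ε * r / 2 := by
      simpa [dist_eq_norm, norm_sub_rev] using (Metric.mem_ball.1 hh).le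
    have h1 : ‖x - (h + w)‖ ≤ ε * r + ε * r / 2 := by
      have : x - (h + w) = ε • (x - z) + (z - h) := by rw [hw]; module
      rw [this]
      refine (norm_add_le _ _).trans (add_le_add ?_ hhz)
      rw [norm_smul, Real.norm_of_nonneg hε.le]
      exact mul_le_mul_of_nonneg_left hxz hε.le
    have h2 := hv.norm_sub_le x (h + w)
    have h3 := hv.norm_sub_le z h
    have h4 : (K : ℝ) * ‖x - (h + w)‖ ≤ K * (ε * r + ε * r / 2) := by gcongr
    have h5 : (K : ℝ) * ‖z - h‖ ≤ K * (ε * r / 2) := by gcongr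
    calc ‖v x - v z - (v (h + w) - v h)‖
        = ‖(v x - v (h + w)) - (v z - v h)‖ := by congr 1; abel
      _ ≤ ‖v x - v (h + w)‖ + ‖v z - v h‖ := _root_.norm_sub_le _ _
      _ ≤ 2 * K * ε * r := by linarith
  have hsplit : volume.real S • (v x - v z)
      = (∫ h in S, ((v x - v z) - (v (h + w) - v h))) + ∫ h in S, (v (h + w) - v h) := by
    have hconst : IntegrableOn (fun _ : Pt => v x - v z) S :=
      integrableOn_const measure_ball_lt_top.ne
    rw [integral_sub hconst hincint]
    simp
  have hint0 : ‖w‖ * ∫ y in interior (SquareD z r), f y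
      ≤ r * δ * (4 / ε ^ 2) * volume.real S := by
    calc ‖w‖ * ∫ y in interior (SquareD z r), f y
        ≤ ‖w‖ * (volume.real (SquareD z r) * δ) := by gcongr
      _ ≤ r * ((4 / ε ^ 2 * volume.real S) * δ) := by gcongr
      _ = _ := by ring
  have hfinal : volume.real S * ‖v x - v z‖
      ≤ volume.real S * (2 * K * ε * r + r * δ * (4 / ε ^ 2)) := by
    calc volume.real S * ‖v x - v z‖ = ‖volume.real S • (v x - v z)‖ := by
          rw [norm_smul, Real.norm_of_nonneg hSpos.le]
      _ ≤ ‖∫ h in S, ((v x - v z) - (v (h + w) - v h))‖ + ‖∫ h in S, (v (h + w) - v h)‖ := by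
          rw [hsplit]; exact norm_add_le _ _
      _ ≤ _ := by linarith
  exact le_of_mul_le_mul_left hfinal hSpos

theorem stmt0 (L : ℝ) (hL : 1 ≤ L) (η : ℝ) (hη : 0 < η) :
    ∃ δ > 0, ∀ (Ω : Set Pt) (u : Pt → Pt), IsOpen Ω → BiLipOn L Ω u →
      ∀ zc ∈ Ω, ∀ M : Pt →L[ℝ] Pt,
        0 < LinearMap.det (M : Pt →ₗ[ℝ] Pt) → ‖M‖ ≤ L → (∀ w : Pt, ‖w‖ ≤ L * ‖M w‖) →
        ∀ ρ > 0, SquareD zc ρ ⊆ Ω →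
          (⨍ z in SquareD zc ρ, ‖fderiv ℝ u z - M‖) ≤ δ →
          ∃ b : Pt, ∀ z ∈ SquareD zc ρ, ‖u z - (M z + b)‖ ≤ η * ρ := by
  lift L to NNReal using zero_le_one.trans hL
  set K : NNReal := lipschitzExtensionConstant Pt * L + L with hK
  have hKpos : (0 : ℝ) < K := by
    have : (0 : ℝ) ≤ lipschitzExtensionConstant Pt * L := by positivity
    rw [hK]; push_cast; linarith
  set ε : ℝ := min 1 (η / (4 * K)) with hε
  have hεpos : 0 < ε := by positivity
  have hεη : 2 * K * ε ≤ η / 2 := by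
    have : ε ≤ η / (4 * K) := min_le_right _ _
    rw [le_div_iff₀ (by positivity)] at this
    linarith
  refine ⟨η * ε ^ 2 / 8, by positivity, ?_⟩
  intro Ω u hΩ hu zc hzc M _ hM _ ρ hρ hQ havg
  have hLip : LipschitzOnWith L u Ω :=
    LipschitzOnWith.of_dist_le_mul fun x hx y hy => (hu x hx y hy).2
  obtain ⟨U, hU, hUu⟩ := (hLip.mono hQ).extend_finite_dimension
  have hMlip : LipschitzWith L M := M.lipschitz.weaken hM
  have hv : LipschitzWith K (fun z => U z - M z) := hU.sub hMlip
  have hQmeas : MeasurableSet (SquareD zc ρ) := (isClosed_squareD zc ρ).measurableSet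
  have hQfin : volume (SquareD zc ρ) ≠ ⊤ :=
    ((measure_mono (squareD_subset_closedBall zc hρ.le)).trans_lt measure_closedBall_lt_top).ne
  have hf : IntegrableOn (fun z => ‖fderiv ℝ u z - M‖) (SquareD zc ρ) := by
    refine Measure.integrableOn_of_bounded (M := L + L) hQfin
      ((measurable_fderiv ℝ u).sub_const M).norm.aestronglyMeasurable ?_
    refine (ae_restrict_iff' hQmeas).2 (Filter.Eventually.of_forall fun z hz => ?_)
    rw [norm_norm]
    exact (norm_sub_le _ _).trans
      (add_le_add (norm_fderiv_le_of_lipschitzOn ℝ (hΩ.mem_nhds (hQ hz)) hLip) hM)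
  have hvf : ∀ y ∈ interior (SquareD zc ρ),
      ‖fderiv ℝ (fun z => U z - M z) y‖ ≤ ‖fderiv ℝ u y - M‖ := by
    intro y hy
    have heq : u =ᶠ[nhds y] U := by
      filter_upwards [mem_interior_iff_mem_nhds.1 hy] with z hz using hUu hz
    rw [heq.fderiv_eq]
    by_cases hd : DifferentiableAt ℝ U y
    · rw [fderiv_fun_sub hd M.differentiableAt, M.fderiv]
    · have : ¬ DifferentiableAt ℝ (fun z => U z - M z) y := fun h => hd (by
        simpa using h.add M.differentiableAt)
      rw [fderiv_zero_of_not_differentiableAt this, norm_zero]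
      exact norm_nonneg _
  have hfδ : ∫ y in interior (SquareD zc ρ), ‖fderiv ℝ u y - M‖
      ≤ volume.real (SquareD zc ρ) * (η * ε ^ 2 / 8) := by
    calc ∫ y in interior (SquareD zc ρ), ‖fderiv ℝ u y - M‖
        ≤ ∫ y in SquareD zc ρ, ‖fderiv ℝ u y - M‖ :=
          setIntegral_mono_set hf (Filter.Eventually.of_forall fun _ => norm_nonneg _)
            interior_subset.eventuallyLE
      _ = volume.real (SquareD zc ρ) * ⨍ y in SquareD zc ρ, ‖fderiv ℝ u y - M‖ := by
          rw [← smul_eq_mul, measure_smul_setAverage _ hQfin]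
      _ ≤ _ := by gcongr
  refine ⟨u zc - M zc, fun z hz => ?_⟩
  have hzcQ : zc ∈ SquareD zc ρ := fun i => by simpa using (half_pos hρ).le
  have hosc := hv.norm_sub_center_le_of_integral_le hρ hεpos (min_le_left _ _) (by positivity) hz
    (hf.mono_set interior_subset) hvf hfδ
  rw [← hUu hz, ← hUu hzcQ] at hosc
  calc ‖u z - (M z + (u zc - M zc))‖ = ‖u z - M z - (u zc - M zc)‖ := by rw [sub_add_eq_sub_sub]
    _ ≤ 2 * K * ε * ρ + ρ * (η * ε ^ 2 / 8) * (4 / ε ^ 2) := hosc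
    _ = (2 * K * ε + η / 2) * ρ := by field_simp; ring
    _ ≤ η * ρ := by gcongr; linarith
end
end

section
/- Let u : Ω → ℝ² be an L bi-Lipschitz map on an open bounded set Ω ⊆ ℝ², and let pq ⊂⊂ Ω be a closed segment. For every δ > 0 there exists a finite subdivision p = z₀, z₁, ..., z_N = q of the segment such that the piecewise affine interpolation u^δ_{pq} of u at the points z_i (defined by u^δ_{pq}(z_i + t(z_{i+1} − z_i)) = u(z_i) + t(u(z_{i+1}) − u(z_i)) for 0 ≤ t ≤ 1) is 4L bi-Lipschitz on pq and satisfies ‖u^δ_{pq} − u‖_{L∞(pq)} ≤ δ. -/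
open MeasureTheory Set

noncomputable section

section PolygonalChain

variable {E : Type*} [NormedAddCommGroup E] [InnerProductSpace ℝ E]

/-- Two segments of length at most `ε` whose endpoints are pairwise at distance at least `ε` are at
distance at least `ε / √2`. -/
lemma sq_le_two_mul_dist_lineMap_sq {A B C D : E} {ε s t : ℝ} (hε : 0 ≤ ε)
    (hs : s ∈ Icc (0 : ℝ) 1) (ht : t ∈ Icc (0 : ℝ) 1)
    (hAB : dist A B ≤ ε) (hCD : dist C D ≤ ε) (hAC : ε ≤ dist A C) (hAD : ε ≤ dist A D)
    (hBC : ε ≤ dist B C) (hBD : ε ≤ dist B D) :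
    ε ^ 2 ≤ 2 * dist (A + s • (B - A)) (C + t • (D - C)) ^ 2 := by
  obtain ⟨hs0, hs1⟩ := hs
  obtain ⟨ht0, ht1⟩ := ht
  have key : dist (A + s • (B - A)) (C + t • (D - C)) ^ 2 =
      (1 - s) * (1 - t) * dist A C ^ 2 + (1 - s) * t * dist A D ^ 2
      + s * (1 - t) * dist B C ^ 2 + s * t * dist B D ^ 2
      - s * (1 - s) * dist A B ^ 2 - t * (1 - t) * dist C D ^ 2 := by
    simp only [dist_eq_norm, ← real_inner_self_eq_norm_sq, inner_add_left, inner_add_right,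
      inner_sub_left, inner_sub_right, real_inner_smul_left, real_inner_smul_right]
    rw [real_inner_comm A B, real_inner_comm A C, real_inner_comm A D, real_inner_comm B C,
      real_inner_comm B D, real_inner_comm C D]
    ring
  have hAB' : dist A B ^ 2 ≤ ε ^ 2 := by gcongr
  have hCD' : dist C D ^ 2 ≤ ε ^ 2 := by gcongr
  have hAC' : ε ^ 2 ≤ dist A C ^ 2 := by gcongr
  have hAD' : ε ^ 2 ≤ dist A D ^ 2 := by gcongr
  have hBC' : ε ^ 2 ≤ dist B C ^ 2 := by gcongr
  have hBD' : ε ^ 2 ≤ dist B D ^ 2 := by gcongr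
  have hs' : 0 ≤ 1 - s := by linarith
  have ht' : 0 ≤ 1 - t := by linarith
  have h1 := mul_le_mul_of_nonneg_left hAC' (mul_nonneg hs' ht')
  have h2 := mul_le_mul_of_nonneg_left hAD' (mul_nonneg hs' ht0)
  have h3 := mul_le_mul_of_nonneg_left hBC' (mul_nonneg hs0 ht')
  have h4 := mul_le_mul_of_nonneg_left hBD' (mul_nonneg hs0 ht0)
  have h5 := mul_le_mul_of_nonneg_left hAB' (mul_nonneg hs0 hs')
  have h6 := mul_le_mul_of_nonneg_left hCD' (mul_nonneg ht0 ht')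
  rw [key]
  nlinarith [mul_nonneg (sq_nonneg (s - 1 / 2)) (sq_nonneg ε),
    mul_nonneg (sq_nonneg (t - 1 / 2)) (sq_nonneg ε)]

/-- If `AC` is a longest side of the triangle `ABC`, then the path along the other two sides is at
most twice as long as the straight line. -/
lemma dist_add_dist_le_two_mul_dist {A B C : E} {s t : ℝ} (hs : s ≤ 1) (ht : 0 ≤ t)
    (hAB : dist A B ≤ dist A C) (hBC : dist B C ≤ dist A C) :
    (1 - s) * dist A B + t * dist B C ≤ 2 * dist (A + s • (B - A)) (B + t • (C - B)) := by
  have key : dist (A + s • (B - A)) (B + t • (C - B)) ^ 2 =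
      ((1 - s) * dist A B) ^ 2 + (t * dist B C) ^ 2
      - (1 - s) * t * (dist A B ^ 2 + dist B C ^ 2 - dist A C ^ 2) := by
    simp only [mul_pow, dist_eq_norm, ← real_inner_self_eq_norm_sq, inner_add_left,
      inner_add_right, inner_sub_left, inner_sub_right, real_inner_smul_left,
      real_inner_smul_right]
    rw [real_inner_comm A B, real_inner_comm A C, real_inner_comm B C]
    ring
  have hα : 0 ≤ dist A B := dist_nonneg
  have hβ : 0 ≤ dist B C := dist_nonneg
  have hprod : dist A B ^ 2 + dist B C ^ 2 - dist A C ^ 2 ≤ dist A B * dist B C := by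
    rcases le_total (dist A B) (dist B C) with h | h <;> nlinarith
  have h1 := mul_le_mul_of_nonneg_left hprod (mul_nonneg (sub_nonneg.2 hs) ht)
  have h2 := sq_nonneg ((1 - s) * dist A B - t * dist B C)
  refine le_of_sq_le_sq ?_ (by positivity)
  nlinarith

lemma nodes_le {t : ℕ → ℝ} {N : ℕ} (ht : ∀ i < N, t i < t (i + 1)) {i j : ℕ} (hij : i ≤ j)
    (hj : j ≤ N) : t i ≤ t j := by
  induction j, hij using Nat.le_induction with
  | base => exact le_rfl
  | succ j _ ih => exact (ih (by omega)).trans (ht j (by omega)).le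

/-- The piecewise affine interpolation of the values `P i` at the nodes `t i`. -/
lemma exists_piecewise_affine (t : ℕ → ℝ) (P : ℕ → E) (N : ℕ) (ht : ∀ i < N, t i < t (i + 1)) :
    ∃ w : ℝ → E, ∀ i < N, ∀ s ∈ Icc (0 : ℝ) 1,
      w (t i + s * (t (i + 1) - t i)) = P i + s • (P (i + 1) - P i) := by
  induction N with
  | zero => exact ⟨fun _ => 0, by simp⟩
  | succ n ih =>
    obtain ⟨w, hw⟩ := ih fun i hi => ht i (by omega)
    refine ⟨fun x => if x < t n then w x else
      P n + ((x - t n) / (t (n + 1) - t n)) • (P (n + 1) - P n), fun i hi s hs => ?_⟩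
    have hpos := ht i hi
    rcases Nat.lt_succ_iff_lt_or_eq.1 hi with hin | rfl
    · have hle : t (i + 1) ≤ t n := nodes_le ht hin (by omega)
      by_cases hx : t i + s * (t (i + 1) - t i) < t n
      · simp only [hx, if_true]
        exact hw i hin s hs
      · have hs1 : s = 1 := by
          by_contra hne
          have : s < 1 := lt_of_le_of_ne hs.2 hne
          nlinarith
        subst hs1
        have hti : t (i + 1) = t n := by linarith
        have hin' : i + 1 = n := by
          by_contra hne
          have h1 := ht (i + 1) (by omega)
          have h2 : t (i + 1 + 1) ≤ t n := nodes_le ht (by omega) (by omega)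
          linarith
        subst hin'
        simp
    · have hx : ¬ t i + s * (t (i + 1) - t i) < t i := by nlinarith [hs.1]
      simp only [hx, if_false]
      congr 2
      have : t (i + 1) - t i ≠ 0 := by linarith
      field_simp
      ring

lemma exists_eq_add_mul_of_mem_Icc (t : ℕ → ℝ) (N : ℕ) (hN : 0 < N)
    (ht : ∀ i < N, t i < t (i + 1)) {x : ℝ} (hx : x ∈ Icc (t 0) (t N)) :
    ∃ i < N, ∃ s ∈ Icc (0 : ℝ) 1, x = t i + s * (t (i + 1) - t i) := by
  induction N with
  | zero => omega
  | succ n ih =>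
    by_cases hn : 0 < n ∧ x ≤ t n
    · obtain ⟨i, hi, h⟩ := ih hn.1 (fun i hi => ht i (by omega)) ⟨hx.1, hn.2⟩
      exact ⟨i, by omega, h⟩
    · have hxn : t n ≤ x := by
        rcases Nat.eq_zero_or_pos n with rfl | h
        · exact hx.1
        · exact le_of_not_ge fun h' => hn ⟨h, h'⟩
      have hpos : 0 < t (n + 1) - t n := sub_pos.2 (ht n (by omega))
      refine ⟨n, by omega, (x - t n) / (t (n + 1) - t n), ⟨?_, ?_⟩, ?_⟩
      · exact div_nonneg (by linarith) hpos.le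
      · rw [div_le_one hpos]; linarith [hx.2]
      · field_simp; ring

/-- Subdivision of `[0, 1]` by last exit times of `γ` from balls of radius `ε`. -/
lemma exists_last_exit_subdivision {F : Type*} [PseudoMetricSpace F] (γ : ℝ → F) {K ε : ℝ}
    (hε : 0 < ε)
    (hγ : ∀ x ∈ Icc (0 : ℝ) 1, ∀ y ∈ Icc (0 : ℝ) 1, dist (γ x) (γ y) ≤ K * |x - y|) :
    ∃ (N : ℕ) (t : ℕ → ℝ), 0 < N ∧ t 0 = 0 ∧ t N = 1 ∧ (∀ i < N, t i < t (i + 1)) ∧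
      (∀ i, t i ∈ Icc (0 : ℝ) 1) ∧ (∀ i < N, dist (γ (t i)) (γ (t (i + 1))) ≤ ε) ∧
      (∀ i j, i < j → j < N → ε ≤ dist (γ (t i)) (γ (t j))) ∧
      (∀ i j, i + 1 < j → j ≤ N → ε ≤ dist (γ (t i)) (γ (t j))) := by
  have hcont : ContinuousOn γ (Icc 0 1) := by
    have : LipschitzOnWith K.toNNReal γ (Icc 0 1) := by
      refine LipschitzOnWith.of_dist_le_mul fun x hx y hy => (hγ x hx y hy).trans ?_
      rw [Real.dist_eq]
      gcongr
      exact Real.le_coe_toNNReal K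
    exact this.continuousOn
  have hnext : ∀ a : Icc (0 : ℝ) 1, ∃ b : Icc (0 : ℝ) 1, a ≤ b ∧ dist (γ a) (γ b) ≤ ε ∧
      (∀ c : Icc (0 : ℝ) 1, b < c → ε < dist (γ a) (γ c)) := by
    intro a
    have hc : Continuous fun c : Icc (0 : ℝ) 1 => dist (γ a) (γ c) :=
      continuous_const.dist hcont.domRestrict
    obtain ⟨b, hb, hmax⟩ := (isClosed_le hc continuous_const :
      IsClosed {c : Icc (0 : ℝ) 1 | dist (γ a) (γ c) ≤ ε}).isCompact.exists_isGreatest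
        ⟨a, by simpa using hε.le⟩
    refine ⟨b, hmax (by simpa using hε.le), hb, fun c hbc => ?_⟩
    by_contra! h
    exact absurd (hmax h) (not_le.2 hbc)
  choose next hle hdist hexit using hnext
  have hge : ∀ a : Icc (0 : ℝ) 1, (next a : ℝ) < 1 → ε ≤ dist (γ a) (γ (next a)) := by
    intro a ha
    by_contra! h
    have hb := (next a).2
    have hc : ContinuousWithinAt (fun x => dist (γ a) (γ x)) (Icc 0 1) (next a) :=
      tendsto_const_nhds.dist (hcont _ hb)
    have hc' : ContinuousWithinAt (fun x => dist (γ a) (γ x)) (Ioc (next a : ℝ) 1) (next a) :=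
      hc.mono fun x hx => ⟨hb.1.trans hx.1.le, hx.2⟩
    have : (nhdsWithin (next a : ℝ) (Ioc (next a : ℝ) 1)).NeBot := by
      rw [nhdsWithin_Ioc_eq_nhdsGT ha]; infer_instance
    obtain ⟨x, hx, hxI⟩ :=
      ((hc'.eventually (gt_mem_nhds h)).and self_mem_nhdsWithin).exists
    have := hexit a ⟨x, hb.1.trans hxI.1.le, hxI.2⟩ hxI.1
    exact absurd hx (not_lt.2 this.le)
  let T : ℕ → Icc (0 : ℝ) 1 := fun i => next^[i] 0
  have hT : ∀ i, T (i + 1) = next (T i) := fun i => Function.iterate_succ_apply' next i 0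
  have hmono : Monotone T := monotone_nat_of_le_succ fun i => by rw [hT]; exact hle _
  have hK : 0 ≤ K := by
    have := hγ 0 (by simp) 1 (by simp)
    simp only [zero_sub, abs_neg, abs_one, mul_one] at this
    exact dist_nonneg.trans this
  have hreach : ∃ i, (T i : ℝ) = 1 := by
    by_contra! hne
    have hlt : ∀ i, (T i : ℝ) < 1 := fun i => lt_of_le_of_ne (T i).2.2 (hne i)
    have hstep : ∀ i : ℕ, i * ε ≤ K * T i := by
      intro i
      induction i with
      | zero => simpa using mul_nonneg hK (T 0).2.1
      | succ i ih =>
        have h1 := hge (T i) (by rw [← hT]; exact hlt _)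
        rw [← hT] at h1
        have h2 := hγ _ (T i).2 _ (T (i + 1)).2
        have h3 : (T i : ℝ) ≤ T (i + 1) := hmono (Nat.le_succ i)
        rw [abs_sub_comm, abs_of_nonneg (sub_nonneg.2 h3)] at h2
        push_cast
        nlinarith
    obtain ⟨n, hn⟩ := exists_nat_gt (K / ε)
    rw [div_lt_iff₀ hε] at hn
    have := hstep n
    nlinarith [mul_le_mul_of_nonneg_left (T n).2.2 hK]
  classical
  have hlt : ∀ i < Nat.find hreach, (T i : ℝ) < 1 := fun i hi =>
    lt_of_le_of_ne (T i).2.2 (Nat.find_min hreach hi)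
  have hN := Nat.find_spec hreach
  set N := Nat.find hreach
  have hstrict : ∀ i < N, T i < T (i + 1) := by
    intro i hi
    refine lt_of_le_of_ne (hmono (Nat.le_succ i)) fun heq => ?_
    have h1 := hge (T i) (by rw [← hT, ← heq]; exact hlt i hi)
    rw [← hT, ← heq, dist_self] at h1
    linarith
  have hfar : ∀ i j, i + 1 < j → j ≤ N → ε ≤ dist (γ (T i)) (γ (T j)) := by
    intro i j hij hj
    refine (hexit (T i) (T j) ?_).le
    rw [← hT]
    exact (hstrict (i + 1) (by omega)).trans_le (hmono (by omega))
  refine ⟨N, fun i => T i, ?_, by simp [T], hN, fun i hi => hstrict i hi, fun i => (T i).2,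
    fun i _ => by simpa only [hT] using hdist (T i), fun i j hij hj => ?_, hfar⟩
  · rcases Nat.eq_zero_or_pos N with h | h
    · rw [h] at hN; simp [T] at hN
    · exact h
  · rcases Nat.lt_or_ge (i + 1) j with h | h
    · exact hfar i j h hj.le
    · obtain rfl : j = i + 1 := by omega
      have := hge (T i) (by rw [← hT]; exact hlt _ hj)
      rwa [← hT] at this

/-- A point of an edge of length at most `ε` is within `ε / 2` of an endpoint. -/
lemma exists_near_endpoint (A B : E) {ε m a b s : ℝ} (hs : s ∈ Icc (0 : ℝ) 1)
    (hAB : dist A B ≤ ε) (hab : |a - b| ≤ m * dist A B) :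
    ∃ c Q, ((c = a ∧ Q = A) ∨ (c = b ∧ Q = B)) ∧
      dist (A + s • (B - A)) Q ≤ ε / 2 ∧
      |a + s * (b - a) - c| ≤ m * dist (A + s • (B - A)) Q := by
  obtain ⟨hs0, hs1⟩ := hs
  have hA : dist (A + s • (B - A)) A = s * dist A B := by
    rw [dist_eq_norm, add_sub_cancel_left, norm_smul, Real.norm_of_nonneg hs0, dist_comm,
      dist_eq_norm]
  have hB : dist (A + s • (B - A)) B = (1 - s) * dist A B := by
    rw [dist_eq_norm, dist_eq_norm, show A + s • (B - A) - B = (1 - s) • (A - B) by module,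
      norm_smul, Real.norm_of_nonneg (sub_nonneg.2 hs1)]
  have h0 : 0 ≤ dist A B := dist_nonneg
  rcases le_total s (1 / 2) with h | h
  · refine ⟨a, A, Or.inl ⟨rfl, rfl⟩, by rw [hA]; nlinarith, ?_⟩
    rw [hA, add_sub_cancel_left, abs_mul, abs_of_nonneg hs0, abs_sub_comm]
    nlinarith
  · refine ⟨b, B, Or.inr ⟨rfl, rfl⟩, by rw [hB]; nlinarith, ?_⟩
    rw [hB, show a + s * (b - a) - b = (1 - s) * (a - b) by ring, abs_mul,
      abs_of_nonneg (sub_nonneg.2 hs1)]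
    nlinarith

lemma dist_affine_le (A B : E) {K a b s s' : ℝ} (hAB : dist A B ≤ K * |a - b|) :
    dist (A + s • (B - A)) (A + s' • (B - A)) ≤ K * |(a + s * (b - a)) - (a + s' * (b - a))| := by
  rw [dist_eq_norm, show A + s • (B - A) - (A + s' • (B - A)) = (s - s') • (B - A) by module,
    show a + s * (b - a) - (a + s' * (b - a)) = (s - s') * (b - a) by ring, norm_smul,
    Real.norm_eq_abs, abs_mul, ← dist_eq_norm, dist_comm, abs_sub_comm b a]
  nlinarith [abs_nonneg (s - s')]

lemma abs_le_dist_affine (A B : E) {m a b s s' : ℝ} (hAB : |a - b| ≤ m * dist A B) :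
    |(a + s * (b - a)) - (a + s' * (b - a))| ≤ m * dist (A + s • (B - A)) (A + s' • (B - A)) := by
  rw [dist_eq_norm, show A + s • (B - A) - (A + s' • (B - A)) = (s - s') • (B - A) by module,
    show a + s * (b - a) - (a + s' * (b - a)) = (s - s') * (b - a) by ring, norm_smul,
    Real.norm_eq_abs, abs_mul, ← dist_eq_norm, dist_comm, abs_sub_comm b a]
  nlinarith [abs_nonneg (s - s')]

/-- A bi-Lipschitz curve on `[0, 1]` is uniformly approximated by interpolating piecewise affine
curves, the lower bi-Lipschitz constant degrading by a factor of at most `4`. -/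
theorem exists_biLipschitz_interpolation (γ : ℝ → E) {K m ε : ℝ} (hε : 0 < ε) (hm : 0 ≤ m)
    (hK : ∀ x ∈ Icc (0 : ℝ) 1, ∀ y ∈ Icc (0 : ℝ) 1, dist (γ x) (γ y) ≤ K * |x - y|)
    (hγ : ∀ x ∈ Icc (0 : ℝ) 1, ∀ y ∈ Icc (0 : ℝ) 1, |x - y| ≤ m * dist (γ x) (γ y)) :
    ∃ (N : ℕ) (t : ℕ → ℝ) (w : ℝ → E), 0 < N ∧ t 0 = 0 ∧ t N = 1 ∧ (∀ i < N, t i < t (i + 1)) ∧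
      (∀ i, t i ∈ Icc (0 : ℝ) 1) ∧
      (∀ i < N, ∀ s ∈ Icc (0 : ℝ) 1, w (t i + s * (t (i + 1) - t i)) =
        γ (t i) + s • (γ (t (i + 1)) - γ (t i))) ∧
      (∀ x ∈ Icc (0 : ℝ) 1, ∀ y ∈ Icc (0 : ℝ) 1,
        dist (w x) (w y) ≤ K * |x - y| ∧ |x - y| ≤ 4 * m * dist (w x) (w y)) ∧
      ∀ x ∈ Icc (0 : ℝ) 1, dist (w x) (γ x) ≤ (1 + K * m) * ε := by
  obtain ⟨N, t, hN, ht0, ht1, hlt, htI, hshort, hfar, hfar'⟩ :=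
    exists_last_exit_subdivision γ hε hK
  obtain ⟨w, hw⟩ := exists_piecewise_affine t (fun i => γ (t i)) N hlt
  have hK0 : 0 ≤ K := by
    have := hK 0 (by simp) 1 (by simp)
    simp only [zero_sub, abs_neg, abs_one, mul_one] at this
    exact dist_nonneg.trans this
  have hloc : ∀ x ∈ Icc (0 : ℝ) 1, ∃ i < N, ∃ s ∈ Icc (0 : ℝ) 1,
      x = t i + s * (t (i + 1) - t i) := fun x hx =>
    exists_eq_add_mul_of_mem_Icc t N hN hlt (by rwa [ht0, ht1])
  have hedgeK : ∀ i, dist (γ (t i)) (γ (t (i + 1))) ≤ K * |t i - t (i + 1)| := fun i =>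
    hK _ (htI _) _ (htI _)
  have hedgem : ∀ i, |t i - t (i + 1)| ≤ m * dist (γ (t i)) (γ (t (i + 1))) := fun i =>
    hγ _ (htI _) _ (htI _)
  -- both estimates for points on the edges `i ≤ j`
  have main : ∀ i j, i ≤ j → j < N → ∀ s ∈ Icc (0 : ℝ) 1, ∀ r ∈ Icc (0 : ℝ) 1, ∀ x y,
      x = t i + s * (t (i + 1) - t i) → y = t j + r * (t (j + 1) - t j) →
      dist (w x) (w y) ≤ K * |x - y| ∧ |x - y| ≤ 4 * m * dist (w x) (w y) := by
    intro i j hij hj s hs r hr x y hx hy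
    have hwx : w x = γ (t i) + s • (γ (t (i + 1)) - γ (t i)) := hx ▸ hw i (by omega) s hs
    have hwy : w y = γ (t j) + r • (γ (t (j + 1)) - γ (t j)) := hy ▸ hw j hj r hr
    rcases hij.eq_or_lt with rfl | hij
    · rw [hwx, hwy, hx, hy]
      refine ⟨dist_affine_le _ _ (hedgeK i), (abs_le_dist_affine _ _ (hedgem i)).trans ?_⟩
      gcongr
      linarith
    have hxr : dist (w x) (γ (t (i + 1))) ≤ K * (t (i + 1) - x) := by
      have := dist_affine_le (s := s) (s' := 1) _ _ (hedgeK i)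
      rw [← hwx, ← hx, one_smul, one_mul, add_sub_cancel, add_sub_cancel, abs_sub_comm,
        abs_of_nonneg] at this
      · exact this
      · nlinarith [hlt i (by omega), hs.2]
    have hyl : dist (γ (t j)) (w y) ≤ K * (y - t j) := by
      have := dist_affine_le (s := 0) (s' := r) _ _ (hedgeK j)
      rw [← hwy, ← hy, zero_smul, zero_mul, add_zero, add_zero, abs_sub_comm,
        abs_of_nonneg] at this
      · exact this
      · nlinarith [hlt j hj, hr.1]
    have htij : t (i + 1) ≤ t j := nodes_le hlt hij hj.le
    have hxle : x ≤ t (i + 1) := by nlinarith [hlt i (by omega), hs.2]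
    have hyge : t j ≤ y := by nlinarith [hlt j hj, hr.1]
    have hxy : |x - y| = y - x := by
      rw [abs_sub_comm, abs_of_nonneg]
      linarith
    constructor
    · have h2 := hK _ (htI (i + 1)) _ (htI j)
      rw [abs_sub_comm, abs_of_nonneg (sub_nonneg.2 htij)] at h2
      have := dist_triangle4 (w x) (γ (t (i + 1))) (γ (t j)) (w y)
      rw [hxy]
      linarith
    · rcases Nat.lt_or_ge (i + 1) j with hij' | hij'
      · have hd : ε ^ 2 ≤ 2 * dist (w x) (w y) ^ 2 := by
          rw [hwx, hwy]
          exact sq_le_two_mul_dist_lineMap_sq hε.le hs hr (hshort i (by omega)) (hshort j hj)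
            (hfar _ _ hij hj) (hfar' _ _ (by omega) (by omega)) (hfar _ _ hij' hj)
            (hfar' _ _ (by omega) (by omega))
        have hd' : 2 * ε ≤ 3 * dist (w x) (w y) := by
          refine le_of_sq_le_sq ?_ (by positivity)
          nlinarith [sq_nonneg (dist (w x) (w y))]
        obtain ⟨c, Q, hcQ, hQ, hc⟩ :=
          exists_near_endpoint _ _ hs (hshort i (by omega)) (hedgem i)
        obtain ⟨c', Q', hcQ', hQ', hc'⟩ := exists_near_endpoint _ _ hr (hshort j hj) (hedgem j)
        rw [← hwx] at hQ hc
        rw [← hwy] at hQ' hc'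
        rw [← hx] at hc
        rw [← hy] at hc'
        have hcc : |c - c'| ≤ m * dist Q Q' := by
          rcases hcQ with ⟨rfl, rfl⟩ | ⟨rfl, rfl⟩ <;> rcases hcQ' with ⟨rfl, rfl⟩ | ⟨rfl, rfl⟩ <;>
            exact hγ _ (htI _) _ (htI _)
        have hQQ := dist_triangle4 Q (w x) (w y) Q'
        rw [dist_comm Q (w x)] at hQQ
        have htri : |x - y| ≤ |x - c| + |c - c'| + |y - c'| := by
          have := dist_triangle4 x c c' y
          rwa [Real.dist_eq, Real.dist_eq, Real.dist_eq, dist_comm c', Real.dist_eq] at this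
        calc |x - y| ≤ m * (dist (w x) Q + dist Q Q' + dist (w y) Q') := by linarith
          _ ≤ m * (4 * dist (w x) (w y)) := by gcongr; linarith
          _ = _ := by ring
      · obtain rfl : j = i + 1 := by omega
        have hAC := hfar' i (i + 1 + 1) (by omega) (by omega)
        have h := dist_add_dist_le_two_mul_dist hs.2 hr.1 ((hshort i (by omega)).trans hAC)
          ((hshort _ hj).trans hAC)
        rw [← hwx, ← hwy] at h
        have h1 := hedgem i
        have h2 := hedgem (i + 1)
        rw [abs_sub_comm, abs_of_nonneg (by linarith [hlt i (by omega)])] at h1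
        rw [abs_sub_comm, abs_of_nonneg (by linarith [hlt _ hj])] at h2
        have h3 := mul_le_mul_of_nonneg_left h1 (sub_nonneg.2 hs.2)
        have h4 := mul_le_mul_of_nonneg_left h2 hr.1
        have h5 := mul_le_mul_of_nonneg_left h hm
        have h6 : 0 ≤ m * dist (w x) (w y) := by positivity
        rw [hxy, hx, hy]
        rw [hx, hy] at h5 h6
        linarith
  refine ⟨N, t, w, hN, ht0, ht1, hlt, htI, hw, fun x hx y hy => ?_, fun x hx => ?_⟩
  · obtain ⟨i, hi, s, hs, hxs⟩ := hloc x hx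
    obtain ⟨j, hj, r, hr, hyr⟩ := hloc y hy
    rcases le_total i j with hij | hij
    · exact main i j hij hj s hs r hr x y hxs hyr
    · rw [abs_sub_comm, dist_comm]
      exact main j i hij hi r hr s hs y x hyr hxs
  · obtain ⟨i, hi, s, hs, hxs⟩ := hloc x hx
    have hwx : w x = γ (t i) + s • (γ (t (i + 1)) - γ (t i)) := hxs ▸ hw i hi s hs
    have h1 : dist (w x) (γ (t i)) ≤ ε := by
      rw [hwx, dist_eq_norm, add_sub_cancel_left, norm_smul, Real.norm_of_nonneg hs.1,
        ← dist_eq_norm, dist_comm]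
      nlinarith [hshort i hi, hs.1, hs.2]
    have h2 : |t i - x| ≤ m * ε := by
      have h3 := hedgem i
      have h4 := mul_le_mul_of_nonneg_left (hshort i hi) hm
      have h5 := hlt i hi
      rw [abs_sub_comm, abs_of_nonneg (by linarith)] at h3
      rw [hxs, sub_add_cancel_left, abs_neg, abs_of_nonneg (mul_nonneg hs.1 (by linarith))]
      nlinarith [hs.2]
    have h3 := hK _ (htI i) _ hx
    have h4 := mul_le_mul_of_nonneg_left h2 hK0
    linarith [dist_triangle (w x) (γ (t i)) (γ x)]

end PolygonalChain

theorem stmt3 (L : ℝ) (hL : 1 ≤ L) (Ω : Set Pt) (hΩ : IsOpen Ω)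
    (hbdd : Bornology.IsBounded Ω) (u : Pt → Pt) (hu : BiLipOn L Ω u)
    (p q : Pt) (hpq : segment ℝ p q ⊆ Ω) (δ : ℝ) (hδ : 0 < δ) :
    ∃ (N : ℕ) (t : ℕ → ℝ) (v : Pt → Pt), 0 < N ∧
      t 0 = 0 ∧ t N = 1 ∧ (∀ i < N, t i < t (i + 1)) ∧
      (∀ i ≤ N, t i ∈ Icc (0 : ℝ) 1) ∧
      (∀ i < N, ∀ s ∈ Icc (0 : ℝ) 1,
        v ((p + t i • (q - p)) + s • ((t (i + 1) - t i) • (q - p))) =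
          u (p + t i • (q - p)) +
            s • (u (p + t (i + 1) • (q - p)) - u (p + t i • (q - p)))) ∧
      BiLipOn (4 * L) (segment ℝ p q) v ∧
      ∀ x ∈ segment ℝ p q, ‖v x - u x‖ ≤ δ := by
  have hmem : ∀ s ∈ Icc (0 : ℝ) 1, p + s • (q - p) ∈ Ω := fun s hs => hpq <| by
    rw [segment_eq_image']; exact ⟨s, hs, rfl⟩
  rcases eq_or_ne p q with rfl | hne
  · refine ⟨1, fun i => i, fun _ => u p, one_pos, by simp, by simp, by simp, ?_, by simp, ?_, ?_⟩
    · intro i hi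
      have : (i : ℝ) ≤ 1 := by exact_mod_cast hi
      exact ⟨by positivity, this⟩
    · intro x hx y hy
      rw [segment_same, mem_singleton_iff] at hx hy
      simp [hx, hy]
    · intro x hx
      rw [segment_same, mem_singleton_iff] at hx
      simp [hx, hδ.le]
  have hℓ : 0 < ‖q - p‖ := norm_pos_iff.2 (sub_ne_zero.2 hne.symm)
  have hL0 : 0 < L := by linarith
  have hdist : ∀ x y : ℝ, dist (p + x • (q - p)) (p + y • (q - p)) = |x - y| * ‖q - p‖ := by
    intro x y
    rw [dist_add_left, dist_eq_norm, ← sub_smul, norm_smul, Real.norm_eq_abs]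
  obtain ⟨N, t, w, hN, ht0, ht1, hlt, htI, hw, hbi, hclose⟩ :=
    exists_biLipschitz_interpolation (fun s => u (p + s • (q - p))) (K := L * ‖q - p‖)
      (m := L / ‖q - p‖) (ε := δ / (1 + L * L)) (by positivity) (by positivity)
      (fun x hx y hy => by
        have := (hu _ (hmem x hx) _ (hmem y hy)).2
        rw [hdist] at this
        linarith)
      (fun x hx y hy => by
        have := (hu _ (hmem x hx) _ (hmem y hy)).1
        rw [hdist, one_div, inv_mul_le_iff₀ hL0] at this
        rwa [div_mul_eq_mul_div, le_div_iff₀ hℓ])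
  have hinj : ∀ x : ℝ, inner ℝ (p + x • (q - p) - p) (q - p) / ‖q - p‖ ^ 2 = x := by
    intro x
    rw [add_sub_cancel_left, real_inner_smul_left, real_inner_self_eq_norm_sq]
    field_simp
  refine ⟨N, t, fun z => w (inner ℝ (z - p) (q - p) / ‖q - p‖ ^ 2), hN, ht0, ht1, hlt,
    fun i _ => htI i, fun i hi s hs => ?_, fun x hx y hy => ?_, fun x hx => ?_⟩
  · rw [← hw i hi s hs, show p + t i • (q - p) + s • (t (i + 1) - t i) • (q - p) =
      p + (t i + s * (t (i + 1) - t i)) • (q - p) by module]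
    simp only [hinj]
  · rw [segment_eq_image'] at hx hy
    obtain ⟨a, ha, rfl⟩ := hx
    obtain ⟨b, hb, rfl⟩ := hy
    obtain ⟨h1, h2⟩ := hbi a ha b hb
    simp only [hinj, hdist]
    constructor
    · rw [one_div, inv_mul_le_iff₀ (by positivity)]
      calc |a - b| * ‖q - p‖ ≤ 4 * (L / ‖q - p‖) * dist (w a) (w b) * ‖q - p‖ := by gcongr
        _ = _ := by field_simp
    · have : 0 ≤ L * (|a - b| * ‖q - p‖) := by positivity
      linarith
  · rw [segment_eq_image'] at hx
    obtain ⟨a, ha, rfl⟩ := hx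
    simp only [hinj]
    rw [← dist_eq_norm]
    refine (hclose a ha).trans (le_of_eq ?_)
    field_simp
end
end
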